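/- arXiv:1806.10249 — 3 statements merged into one kernel-verified Lean document; each statement's English description precedes it below -/
import Mathlib

section
/- Let V be a finite-dimensional complex inner product space, let U : V → V be unitary with an orthonormal eigenbasis {u_m} and eigenvalues e^{iφ_m} (φ_m ∈ ℝ), let w ∈ V be a unit vector, and define U' = U∘(I − 2·|w⟩⟨w|). Suppose U' v = e^{iλ} v for some λ ∈ ℝ and nonzero v ∈ V with ⟨w, v⟩ ≠ 0, and suppose e^{i(λ−φ_m)} ≠ 1 for every m. Then ∑_m |⟨u_m, w⟩|² · sin(λ − φ_m)/(1 − cos(λ − φ_m)) = 0. -/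
/-!
Exact spectral condition of spatial search: if `U` is unitary with orthonormal
eigenbasis `{u_m}` and eigenvalues `e^{iφ_m}`, `w` is a unit vector,
`U' = U(I − 2|w⟩⟨w|)` has eigenvector `v` with eigenvalue `e^{iλ}` and `⟨w,v⟩ ≠ 0`,
and `e^{i(λ−φ_m)} ≠ 1` for all `m`, then
`∑_m |⟨u_m, w⟩|² sin(λ−φ_m)/(1 − cos(λ−φ_m)) = 0`.
-/

noncomputable section

open scoped InnerProductSpace

theorem stmt12 {V : Type*} [NormedAddCommGroup V] [InnerProductSpace ℂ V]
    [FiniteDimensional ℂ V] {ι : Type*} [Fintype ι]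
    (U : V →ₗ[ℂ] V) (hU : ∀ x y : V, ⟪U x, U y⟫_ℂ = ⟪x, y⟫_ℂ)
    (u : ι → V) (hON : Orthonormal ℂ u)
    (hspan : Submodule.span ℂ (Set.range u) = ⊤)
    (φ : ι → ℝ) (heig : ∀ m, U (u m) = Complex.exp (Complex.I * φ m) • u m)
    (w : V) (hw : ‖w‖ = 1)
    (U' : V →ₗ[ℂ] V) (hU' : ∀ x : V, U' x = U (x - (2 : ℂ) • ⟪w, x⟫_ℂ • w))
    (lam : ℝ) (v : V) (hv : v ≠ 0) (hvw : ⟪w, v⟫_ℂ ≠ 0)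
    (heigv : U' v = Complex.exp (Complex.I * lam) • v)
    (hres : ∀ m, Complex.exp (Complex.I * (lam - φ m)) ≠ 1) :
    ∑ m, ‖⟪u m, w⟫_ℂ‖ ^ 2 *
      (Real.sin (lam - φ m) / (1 - Real.cos (lam - φ m))) = 0 := by
  classical
  let B : OrthonormalBasis ι ℂ V := OrthonormalBasis.mk hON hspan.ge
  have hB : ∀ m, B m = u m := fun m => by simp [B]
  have hsum : ∑ m, ⟪w, u m⟫_ℂ * ⟪u m, v⟫_ℂ = ⟪w, v⟫_ℂ := by
    have h := B.sum_inner_mul_inner w v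
    simpa only [hB] using h
  have hUm : ∀ m x, ⟪u m, U x⟫_ℂ = Complex.exp (Complex.I * φ m) * ⟪u m, x⟫_ℂ := by
    intro m x
    have h := hU (u m) x
    rw [heig, inner_smul_left, ← Complex.exp_conj] at h
    rw [← h, ← mul_assoc, ← Complex.exp_add]
    simp
  have hterm : ∀ m, ⟪w, u m⟫_ℂ * ⟪u m, v⟫_ℂ = ⟪w, v⟫_ℂ *
      (((‖⟪u m, w⟫_ℂ‖ ^ 2 : ℝ) : ℂ) * (1 + Complex.I *
        ((Real.sin (lam - φ m) / (1 - Real.cos (lam - φ m)) : ℝ) : ℂ))) := by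
    intro m
    have h1 : Complex.exp (Complex.I * lam) * ⟪u m, v⟫_ℂ =
        Complex.exp (Complex.I * φ m) * (⟪u m, v⟫_ℂ - 2 * (⟪w, v⟫_ℂ * ⟪u m, w⟫_ℂ)) := by
      rw [← inner_smul_right, ← heigv, hU', hUm, inner_sub_right, inner_smul_right,
        inner_smul_right]
    have hz := hres m
    have h2 : Complex.exp (Complex.I * lam) =
        Complex.exp (Complex.I * φ m) * Complex.exp (Complex.I * (lam - φ m)) := by
      rw [← Complex.exp_add]; congr 1; ring
    have h3 : Complex.exp (Complex.I * (lam - φ m)) * ⟪u m, v⟫_ℂ =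
        ⟪u m, v⟫_ℂ - 2 * (⟪w, v⟫_ℂ * ⟪u m, w⟫_ℂ) := by
      rw [h2, mul_assoc] at h1
      exact mul_left_cancel₀ (Complex.exp_ne_zero _) h1
    have hn : ((‖⟪u m, w⟫_ℂ‖ ^ 2 : ℝ) : ℂ) = ⟪w, u m⟫_ℂ * ⟪u m, w⟫_ℂ := by
      rw [← inner_conj_symm w (u m), Complex.conj_mul']; push_cast; rfl
    have he : Complex.exp (Complex.I * (lam - φ m)) =
        (Real.cos (lam - φ m) : ℂ) + Complex.I * (Real.sin (lam - φ m) : ℂ) := by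
      rw [mul_comm Complex.I, Complex.exp_mul_I]; push_cast; ring
    have hc : (1 - Real.cos (lam - φ m)) ≠ 0 := by
      intro h
      have hc1 : Real.cos (lam - φ m) = 1 := by linarith
      have hs : Real.sin (lam - φ m) = 0 := by
        have := Real.sin_sq_add_cos_sq (lam - φ m)
        rw [hc1] at this
        exact pow_eq_zero_iff two_ne_zero |>.1 (by linarith)
      apply hz
      rw [he, hc1, hs]; simp
    have hkey : (1 - Complex.exp (Complex.I * (lam - φ m))) * (1 + Complex.I *
        ((Real.sin (lam - φ m) / (1 - Real.cos (lam - φ m)) : ℝ) : ℂ)) = 2 := by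
      have hsq := Real.sin_sq_add_cos_sq (lam - φ m)
      rw [he]
      generalize Real.sin (lam - φ m) = s at *
      generalize Real.cos (lam - φ m) = c at *
      have hc' : (1 - (c : ℂ)) ≠ 0 := by exact_mod_cast hc
      have hsq' : (s : ℂ) ^ 2 + (c : ℂ) ^ 2 = 1 := by exact_mod_cast hsq
      push_cast
      field_simp
      linear_combination hsq' - (s : ℂ) ^ 2 * Complex.I_sq
    apply mul_left_cancel₀ (sub_ne_zero.2 hz.symm)
    rw [hn]
    linear_combination (-⟪w, u m⟫_ℂ) * h3 -
      ⟪w, v⟫_ℂ * (⟪w, u m⟫_ℂ * ⟪u m, w⟫_ℂ) * hkey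
  rw [Finset.sum_congr rfl fun m _ => hterm m, ← Finset.mul_sum] at hsum
  have h1 := mul_left_cancel₀ hvw (hsum.trans (mul_one _).symm)
  have h2 := congrArg Complex.im h1
  rw [Complex.im_sum] at h2
  rw [Complex.one_im] at h2
  rw [← h2]
  refine Finset.sum_congr rfl fun m _ => ?_
  rw [Complex.im_ofReal_mul, Complex.add_im, Complex.I_mul_im, Complex.ofReal_re, Complex.one_im,
    zero_add]
end
end

section
/- Let n ≥ 4 be an even integer and set a_{kℓ} = (3/4)(1/3 − cos(2πk/n) − cos(2πℓ/n) − cos(2π(k−ℓ)/n)). Then for all integers k, ℓ with 0 ≤ k, ℓ < n/2 and (k,ℓ) ≠ (0,0): 12(k² − kℓ + ℓ²)/n² ≤ 2 + a_{kℓ} ≤ 3π²(k² − kℓ + ℓ²)/n²; in particular 2 + a_{kℓ} > 0. -/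
/-!
Sandwich bound for the eigenphase quantity of the staggered walk at `θ = π/3`:
for even `n ≥ 4` and `0 ≤ k, ℓ < n/2` with `(k,ℓ) ≠ (0,0)`,
`12(k² − kℓ + ℓ²)/n² ≤ 2 + a_{kℓ} ≤ 3π²(k² − kℓ + ℓ²)/n²`, in particular `2 + a_{kℓ} > 0`.
-/

open scoped Real

theorem stmt14 (n : ℕ) (hn : 4 ≤ n) (hEven : Even n) (k l : ℕ)
    (hk : (k : ℝ) < n / 2) (hl : (l : ℝ) < n / 2) (hkl : (k, l) ≠ (0, 0))
    (a : ℝ)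
    (ha : a = 3 / 4 * (1 / 3 - Real.cos (2 * π * k / n) - Real.cos (2 * π * l / n) -
      Real.cos (2 * π * ((k : ℝ) - l) / n))) :
    12 * ((k : ℝ) ^ 2 - k * l + (l : ℝ) ^ 2) / (n : ℝ) ^ 2 ≤ 2 + a ∧
    2 + a ≤ 3 * π ^ 2 * ((k : ℝ) ^ 2 - k * l + (l : ℝ) ^ 2) / (n : ℝ) ^ 2 ∧
    0 < 2 + a := by
  have hn0 : (0 : ℝ) < n := by
    have : 0 < n := by omega
    exact_mod_cast this
  have hk0 : (0 : ℝ) ≤ k := Nat.cast_nonneg k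
  have hl0 : (0 : ℝ) ≤ l := Nat.cast_nonneg l
  have hQ : 0 < (k : ℝ) ^ 2 - k * l + (l : ℝ) ^ 2 := by
    have h : k ≠ 0 ∨ l ≠ 0 := by
      by_contra! h
      exact hkl (by rw [h.1, h.2])
    rcases h with h | h
    · have h1 : (0 : ℝ) < k := by exact_mod_cast Nat.pos_of_ne_zero h
      nlinarith [sq_nonneg ((k : ℝ) - 2 * l), pow_pos h1 2]
    · have h1 : (0 : ℝ) < l := by exact_mod_cast Nat.pos_of_ne_zero h
      nlinarith [sq_nonneg (2 * (k : ℝ) - l), pow_pos h1 2]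
  have low : ∀ t : ℝ, -(n / 2 : ℝ) ≤ t → t ≤ n / 2 →
      Real.cos (2 * π * t / n) ≤ 1 - 8 * (t ^ 2 / (n : ℝ) ^ 2) := by
    intro t h1 h2
    have h := Real.cos_le_one_sub_mul_cos_sq (x := 2 * π * t / n) (by
      rw [abs_le]
      constructor
      · rw [le_div_iff₀ hn0]; nlinarith [Real.pi_pos]
      · rw [div_le_iff₀ hn0]; nlinarith [Real.pi_pos])
    have e : 2 / π ^ 2 * (2 * π * t / n) ^ 2 = 8 * (t ^ 2 / (n : ℝ) ^ 2) := by
      have := Real.pi_ne_zero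
      field_simp
      ring
    linarith
  have up : ∀ t : ℝ, 1 - 2 * π ^ 2 * (t ^ 2 / (n : ℝ) ^ 2) ≤ Real.cos (2 * π * t / n) := by
    intro t
    have h := Real.one_sub_sq_div_two_le_cos (x := 2 * π * t / n)
    have e : (2 * π * t / n) ^ 2 / 2 = 2 * π ^ 2 * (t ^ 2 / (n : ℝ) ^ 2) := by ring
    linarith
  have a1 := low k (by linarith) (by linarith)
  have a2 := low l (by linarith) (by linarith)
  have a3 := low (k - l) (by linarith) (by linarith)
  have b1 := up k
  have b2 := up l
  have b3 := up (k - l)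
  have L : 12 * ((k : ℝ) ^ 2 - k * l + (l : ℝ) ^ 2) / (n : ℝ) ^ 2 ≤ 2 + a := by
    have e : 12 * ((k : ℝ) ^ 2 - k * l + (l : ℝ) ^ 2) / (n : ℝ) ^ 2 =
      3 / 4 * (8 * ((k : ℝ) ^ 2 / (n : ℝ) ^ 2) + 8 * ((l : ℝ) ^ 2 / (n : ℝ) ^ 2)
        + 8 * (((k : ℝ) - l) ^ 2 / (n : ℝ) ^ 2)) := by ring
    rw [e]
    linarith
  refine ⟨L, ?_, lt_of_lt_of_le (by positivity) L⟩
  have e : 3 * π ^ 2 * ((k : ℝ) ^ 2 - k * l + (l : ℝ) ^ 2) / (n : ℝ) ^ 2 =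
      3 / 4 * (2 * π ^ 2 * ((k : ℝ) ^ 2 / (n : ℝ) ^ 2) + 2 * π ^ 2 * ((l : ℝ) ^ 2 / (n : ℝ) ^ 2)
        + 2 * π ^ 2 * (((k : ℝ) - l) ^ 2 / (n : ℝ) ^ 2)) := by ring
  rw [e]
  linarith
end

section
/- Define, for even n ≥ 4, a_{kℓ} = (3/4)(1/3 − cos(2πk/n) − cos(2πℓ/n) − cos(2π(k−ℓ)/n)) and C(n)² = (1/n²)·∑_{0 ≤ k, ℓ ≤ n−1, (k,ℓ) ≠ (0,0)} 1/(2 + a_{kℓ}). Then there exist constants c₁, c₂ > 0 and N₀ such that c₁·ln n ≤ C(n)² ≤ c₂·ln n for all even n ≥ N₀; that is, C(n) = Θ(√(ln n)). -/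
/-!
The normalization constant of the hexagonal-lattice search analysis:
`C(n)² = (1/n²) ∑_{(k,ℓ)≠(0,0)} 1/(2 + a_{kℓ})` is `Θ(ln n)`, i.e. `C(n) = Θ(√(ln n))`.
-/

noncomputable section

open scoped Real

/-- The eigenphase quantity `a_{kℓ}` at `θ = π/3`. -/
def hexAkl (n k l : ℕ) : ℝ :=
  3 / 4 * (1 / 3 - Real.cos (2 * π * k / n) - Real.cos (2 * π * l / n) -
    Real.cos (2 * π * ((k : ℝ) - l) / n))

/-- `C(n)² = (1/n²) ∑_{0 ≤ k,ℓ ≤ n−1, (k,ℓ)≠(0,0)} 1/(2 + a_{kℓ})`. -/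
def hexCsq (n : ℕ) : ℝ :=
  (1 / (n : ℝ) ^ 2) * ∑ k ∈ Finset.range n, ∑ l ∈ Finset.range n,
    if (k, l) ≠ (0, 0) then 1 / (2 + hexAkl n k l) else 0

lemma hex_pos_form (n k l : ℕ) : 2 + hexAkl n k l =
    3 / 4 * ((1 - Real.cos (2 * π * k / n)) + (1 - Real.cos (2 * π * l / n)) +
      (1 - Real.cos (2 * π * ((k : ℝ) - l) / n))) := by
  unfold hexAkl; ring

lemma hex_upper (n k l : ℕ) : 2 + hexAkl n k l ≤ 3 * π ^ 2 * ((k : ℝ) ^ 2 + l ^ 2) / n ^ 2 := by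
  rw [hex_pos_form]
  have h1 := Real.one_sub_sq_div_two_le_cos (x := 2 * π * k / n)
  have h2 := Real.one_sub_sq_div_two_le_cos (x := 2 * π * l / n)
  have h3 := Real.one_sub_sq_div_two_le_cos (x := 2 * π * ((k : ℝ) - l) / n)
  have h4 : (2 * π * ((k : ℝ) - l) / n) ^ 2 ≤ (2 * π * k / n) ^ 2 + (2 * π * l / n) ^ 2 := by
    have : 0 ≤ (2 * π * k / n) * (2 * π * l / n) := by positivity
    have e : 2 * π * ((k : ℝ) - l) / n = 2 * π * k / n - 2 * π * l / n := by ring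
    rw [e]; nlinarith
  have e : 3 * π ^ 2 * ((k : ℝ) ^ 2 + l ^ 2) / n ^ 2 =
      3 / 4 * ((2 * π * k / n) ^ 2 + (2 * π * l / n) ^ 2) := by ring
  rw [e]; linarith

lemma cos_fold (n k : ℕ) (hk : k < n) :
    8 * ((min k (n - k) : ℕ) : ℝ) ^ 2 / n ^ 2 ≤ 1 - Real.cos (2 * π * k / n) := by
  have hn : (0 : ℝ) < n := by exact_mod_cast (by omega : 0 < n)
  have key : ∀ m : ℕ, 2 * m ≤ n → 8 * (m : ℝ) ^ 2 / n ^ 2 ≤ 1 - Real.cos (2 * π * m / n) := by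
    intro m hm
    have hm' : 2 * (m : ℝ) ≤ n := by exact_mod_cast hm
    have hab : |2 * π * m / n| ≤ π := by
      rw [abs_of_nonneg (by positivity), div_le_iff₀ hn]
      nlinarith [Real.pi_pos]
    have h := Real.cos_le_one_sub_mul_cos_sq hab
    have e : 2 / π ^ 2 * (2 * π * m / n) ^ 2 = 8 * (m : ℝ) ^ 2 / n ^ 2 := by
      have := Real.pi_pos.ne'
      field_simp; ring
    linarith
  rcases le_total k (n - k) with h | h
  · rw [min_eq_left h]; exact key k (by omega)
  · rw [min_eq_right h]
    have h2 := key (n - k) (by omega)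
    have e : 2 * π * ((n - k : ℕ) : ℝ) / n = 2 * π - 2 * π * k / n := by
      rw [Nat.cast_sub hk.le]; field_simp
    rw [e, Real.cos_two_pi_sub] at h2
    exact h2

lemma hex_lower (n k l : ℕ) (hk : k < n) (hl : l < n) :
    6 * (((min k (n - k) : ℕ) : ℝ) ^ 2 + ((min l (n - l) : ℕ) : ℝ) ^ 2) / n ^ 2 ≤
      2 + hexAkl n k l := by
  rw [hex_pos_form]
  have h1 := cos_fold n k hk
  have h2 := cos_fold n l hl
  have h3 := Real.cos_le_one (2 * π * ((k : ℝ) - l) / n)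
  have e : 6 * (((min k (n - k) : ℕ) : ℝ) ^ 2 + ((min l (n - l) : ℕ) : ℝ) ^ 2) / n ^ 2 =
    3 / 4 * (8 * ((min k (n - k) : ℕ) : ℝ) ^ 2 / n ^ 2 +
      8 * ((min l (n - l) : ℕ) : ℝ) ^ 2 / n ^ 2) := by ring
  rw [e]; linarith

lemma fold_sum (n : ℕ) (f : ℕ → ℝ) (hf : ∀ i, 0 ≤ f i) :
    ∑ k ∈ Finset.range n, f (min k (n - k)) ≤ 2 * ∑ k ∈ Finset.range (n + 1), f k := by
  have h1 : ∑ k ∈ Finset.range n, f (min k (n - k)) ≤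
      ∑ k ∈ Finset.range (n + 1), (f k + f (n - k)) := by
    rw [Finset.sum_range_succ]
    have : ∑ k ∈ Finset.range n, f (min k (n - k)) ≤
      ∑ k ∈ Finset.range n, (f k + f (n - k)) := by
      apply Finset.sum_le_sum
      intro k _
      rcases le_total k (n - k) with h | h
      · rw [min_eq_left h]; linarith [hf (n - k)]
      · rw [min_eq_right h]; linarith [hf k]
    linarith [hf n, hf (n - n)]
  rw [Finset.sum_add_distrib] at h1
  have h2 := Finset.sum_range_reflect f (n + 1)
  simp only [Nat.add_sub_cancel] at h2
  have h3 : ∑ k ∈ Finset.range (n + 1), f (n - k) = ∑ k ∈ Finset.range (n + 1), f k := by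
    rw [← h2]
  linarith

lemma row_sum (m N : ℕ) (hm : 0 < m) :
    ∑ j ∈ Finset.range N, 1 / ((m : ℝ) ^ 2 + j ^ 2) ≤ 4 / (m : ℝ) := by
  have hm' : (0 : ℝ) < m := by exact_mod_cast hm
  suffices h : ∑ j ∈ Finset.range N, 1 / ((m : ℝ) ^ 2 + j ^ 2) ≤ 4 / (m : ℝ) - 4 / ((m : ℝ) + N) by
    have : (0 : ℝ) ≤ 4 / (m + N) := by positivity
    linarith
  induction N with
  | zero => simp
  | succ N ih =>
    rw [Finset.sum_range_succ]
    have : 1 / ((m : ℝ) ^ 2 + N ^ 2) ≤ 4 / (m + N) - 4 / (m + (N + 1 : ℕ)) := by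
      have hm1 : (1 : ℝ) ≤ m := by exact_mod_cast hm
      have hN : (0 : ℝ) ≤ N := by positivity
      push_cast
      rw [div_sub_div _ _ (by positivity) (by positivity),
        div_le_div_iff₀ (by positivity) (by positivity)]
      nlinarith [sq_nonneg ((m : ℝ) - N)]
    linarith

lemma double_sum (n : ℕ) :
    ∑ i ∈ Finset.range (n + 1), ∑ j ∈ Finset.range (n + 1), 1 / ((i : ℝ) ^ 2 + (j : ℝ) ^ 2) ≤
      5 * ((harmonic n : ℚ) : ℝ) := by
  have hH : ((harmonic n : ℚ) : ℝ) = ∑ i ∈ Finset.range n, ((i : ℝ) + 1)⁻¹ := by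
    simp [harmonic]
  rw [Finset.sum_range_succ']
  have h1 : ∑ i ∈ Finset.range n, ∑ j ∈ Finset.range (n + 1),
      1 / (((i + 1 : ℕ) : ℝ) ^ 2 + (j : ℝ) ^ 2) ≤ 4 * ((harmonic n : ℚ) : ℝ) := by
    rw [hH, Finset.mul_sum]
    apply Finset.sum_le_sum
    intro i _
    have := row_sum (i + 1) (n + 1) (by omega)
    push_cast at this ⊢
    rwa [div_eq_mul_inv 4] at this
  have h2 : ∑ j ∈ Finset.range (n + 1), 1 / (((0 : ℕ) : ℝ) ^ 2 + (j : ℝ) ^ 2) ≤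
      ((harmonic n : ℚ) : ℝ) := by
    rw [hH, Finset.sum_range_succ']
    simp only [Nat.cast_zero, ne_eq, OfNat.ofNat_ne_zero, not_false_eq_true, zero_pow, add_zero,
      div_zero, zero_add]
    apply Finset.sum_le_sum
    intro j _
    rw [one_div]
    apply inv_anti₀ (by positivity)
    push_cast
    have : (0 : ℝ) ≤ j := by positivity
    nlinarith
  linarith

lemma upper_bound (n : ℕ) (hn : 0 < n) : hexCsq n ≤ 10 / 3 * ((harmonic n : ℚ) : ℝ) := by
  have hn' : (0 : ℝ) < n := by exact_mod_cast hn
  have hterm : ∀ k ∈ Finset.range n, ∀ l ∈ Finset.range n,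
      (if (k, l) ≠ (0, 0) then 1 / (2 + hexAkl n k l) else 0) ≤
      (n : ℝ) ^ 2 / 6 * (1 / (((min k (n - k) : ℕ) : ℝ) ^ 2 + ((min l (n - l) : ℕ) : ℝ) ^ 2)) := by
    intro k hk l hl
    rw [Finset.mem_range] at hk hl
    split_ifs with h
    · have hlow := hex_lower n k l hk hl
      have hpos : 0 < ((min k (n - k) : ℕ) : ℝ) ^ 2 + ((min l (n - l) : ℕ) : ℝ) ^ 2 := by
        by_cases hk0 : k = 0
        · have hl0 : l ≠ 0 := by
            rintro rfl; exact h (by rw [hk0])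
          have : 0 < min l (n - l) := by omega
          have : (0 : ℝ) < ((min l (n - l) : ℕ) : ℝ) := by exact_mod_cast this
          positivity
        · have : 0 < min k (n - k) := by omega
          have : (0 : ℝ) < ((min k (n - k) : ℕ) : ℝ) := by exact_mod_cast this
          positivity
      refine (one_div_le_one_div_of_le (by positivity) hlow).trans (le_of_eq ?_)
      field_simp
    · positivity
  have hsum : ∑ k ∈ Finset.range n, ∑ l ∈ Finset.range n,
      (if (k, l) ≠ (0, 0) then 1 / (2 + hexAkl n k l) else 0) ≤
      (n : ℝ) ^ 2 / 6 * (20 * ((harmonic n : ℚ) : ℝ)) := by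
    refine (Finset.sum_le_sum fun k hk => Finset.sum_le_sum (hterm k hk)).trans ?_
    simp_rw [← Finset.mul_sum]
    apply mul_le_mul_of_nonneg_left _ (by positivity)
    have a1 := fold_sum n (fun i => ∑ l ∈ Finset.range n,
      1 / ((i : ℝ) ^ 2 + ((min l (n - l) : ℕ) : ℝ) ^ 2)) (fun i => by positivity)
    have a2 : ∑ i ∈ Finset.range (n + 1), ∑ l ∈ Finset.range n,
      1 / ((i : ℝ) ^ 2 + ((min l (n - l) : ℕ) : ℝ) ^ 2) ≤
      ∑ i ∈ Finset.range (n + 1), 2 * ∑ j ∈ Finset.range (n + 1),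
        1 / ((i : ℝ) ^ 2 + (j : ℝ) ^ 2) := by
      apply Finset.sum_le_sum
      intro i _
      exact fold_sum n (fun j => 1 / ((i : ℝ) ^ 2 + (j : ℝ) ^ 2)) (fun j => by positivity)
    rw [← Finset.mul_sum] at a2
    have a3 := double_sum n
    linarith
  unfold hexCsq
  refine (mul_le_mul_of_nonneg_left hsum (by positivity)).trans (le_of_eq ?_)
  field_simp
  ring

lemma lower_bound (n : ℕ) :
    1 / (6 * π ^ 2) * ((harmonic n : ℚ) : ℝ) ≤ hexCsq (n + 1) := by
  have hH : ((harmonic n : ℚ) : ℝ) = ∑ i ∈ Finset.range n, ((i : ℝ) + 1)⁻¹ := by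
    simp [harmonic]
  have hpi := Real.pi_pos
  have hnn : ∀ k l : ℕ, 0 ≤ 2 + hexAkl (n + 1) k l := by
    intro k l
    rw [hex_pos_form]
    linarith [Real.cos_le_one (2 * π * k / (n + 1 : ℕ)), Real.cos_le_one (2 * π * l / (n + 1 : ℕ)),
      Real.cos_le_one (2 * π * ((k : ℝ) - l) / (n + 1 : ℕ))]
  have hterm0 : ∀ k l : ℕ, (0 : ℝ) ≤
      if (k, l) ≠ (0, 0) then 1 / (2 + hexAkl (n + 1) k l) else 0 := by
    intro k l
    split_ifs
    · exact one_div_nonneg.2 (hnn k l)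
    · exact le_rfl
  have hrow : ∀ i ∈ Finset.range n,
      ((n + 1 : ℕ) : ℝ) ^ 2 / (6 * π ^ 2) * ((i : ℝ) + 1)⁻¹ ≤
      ∑ l ∈ Finset.range (n + 1),
        if (i + 1, l) ≠ (0, 0) then 1 / (2 + hexAkl (n + 1) (i + 1) l) else 0 := by
    intro i hi
    rw [Finset.mem_range] at hi
    have hsub : Finset.range (i + 1) ⊆ Finset.range (n + 1) := by
      intro x hx; rw [Finset.mem_range] at *; omega
    refine le_trans ?_ (Finset.sum_le_sum_of_subset_of_nonneg hsub
      (fun l _ _ => hterm0 (i + 1) l))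
    have hc : ∀ l ∈ Finset.range (i + 1),
        ((n + 1 : ℕ) : ℝ) ^ 2 / (6 * π ^ 2 * ((i : ℝ) + 1) ^ 2) ≤
        if (i + 1, l) ≠ (0, 0) then 1 / (2 + hexAkl (n + 1) (i + 1) l) else 0 := by
      intro l hl
      rw [Finset.mem_range] at hl
      rw [if_pos (by simp)]
      have hlow := hex_lower (n + 1) (i + 1) l (by omega) (by omega)
      have hup := hex_upper (n + 1) (i + 1) l
      have hpos : 0 < 2 + hexAkl (n + 1) (i + 1) l := by
        refine lt_of_lt_of_le ?_ hlow
        have : 0 < min (i + 1) (n + 1 - (i + 1)) := by omega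
        have : (0 : ℝ) < ((min (i + 1) (n + 1 - (i + 1)) : ℕ) : ℝ) := by exact_mod_cast this
        positivity
      have hl' : (l : ℝ) ≤ i + 1 := by exact_mod_cast hl.le
      have hup2 : 2 + hexAkl (n + 1) (i + 1) l ≤
          6 * π ^ 2 * ((i : ℝ) + 1) ^ 2 / ((n + 1 : ℕ) : ℝ) ^ 2 := by
        refine hup.trans ?_
        apply div_le_div_of_nonneg_right _ (by positivity)
        have h2 : (l : ℝ) ^ 2 ≤ (i + 1) ^ 2 := by gcongr
        push_cast
        nlinarith [sq_pos_of_pos hpi]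
      refine le_trans (le_of_eq ?_) (one_div_le_one_div_of_le hpos hup2)
      rw [one_div_div]
    refine le_trans (le_of_eq ?_) (Finset.sum_le_sum hc)
    rw [Finset.sum_const, Finset.card_range, nsmul_eq_mul]
    push_cast
    field_simp
  have hsum : ((n + 1 : ℕ) : ℝ) ^ 2 / (6 * π ^ 2) * ((harmonic n : ℚ) : ℝ) ≤
      ∑ k ∈ Finset.range (n + 1), ∑ l ∈ Finset.range (n + 1),
        if (k, l) ≠ (0, 0) then 1 / (2 + hexAkl (n + 1) k l) else 0 := by
    rw [Finset.sum_range_succ', hH, Finset.mul_sum]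
    have := Finset.sum_le_sum hrow
    have h0 := Finset.sum_nonneg (s := Finset.range (n + 1)) (fun l _ => hterm0 0 l)
    linarith
  unfold hexCsq
  refine le_trans (le_of_eq ?_) (mul_le_mul_of_nonneg_left hsum (by positivity))
  field_simp

theorem stmt16 :
    ∃ c₁ > (0 : ℝ), ∃ c₂ > (0 : ℝ), ∃ N₀ : ℕ, ∀ n : ℕ, Even n → N₀ ≤ n →
      c₁ * Real.log n ≤ hexCsq n ∧ hexCsq n ≤ c₂ * Real.log n := by
  have hpi := Real.pi_pos
  refine ⟨1 / (6 * π ^ 2), by positivity, 10, by norm_num, 3, ?_⟩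
  intro n _ hn
  constructor
  · obtain ⟨m, rfl⟩ : ∃ m, n = m + 1 := ⟨n - 1, by omega⟩
    exact (mul_le_mul_of_nonneg_left (log_add_one_le_harmonic m) (by positivity)).trans
      (lower_bound m)
  · have h1 := upper_bound n (by omega)
    have h2 := harmonic_le_one_add_log n
    have h3 : 1 ≤ Real.log n := by
      rw [Real.le_log_iff_exp_le (by exact_mod_cast (by omega : 0 < n))]
      have : (3 : ℝ) ≤ n := by exact_mod_cast hn
      linarith [Real.exp_one_lt_d9]
    linarith
end
end
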